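/- Let M=(E,r,m) be an rsm over ℝ and t ≠ 0. Define the flow polynomial F_{M|A}(t) := ∑_{B⊆A} (−1)^{|A∖B|} m(B) t^{|B|−r(B)} (integer zpow powers). Then for every family p=(p_e)_{e∈E} of reals: E[F_{M|E_p}(t)] = ∑_{A⊆E} m(A) t^{|A|−r(A)} p^A (1−2p)^{E∖A}, where (1−2p)^{E∖A} := ∏_{e∈E∖A}(1−2p_e). Moreover, setting B := {e ∈ E : p_e = 1/2}: if B = E then E[F_{M|E_p}(t)] = 2^{−|E|} t^{|E|−r(E)} m(E); and if B ⊊ E then E[F_{M|E_p}(t)] = 2^{−|B|} t^{|B|−r(B)} (1−2p)^{E∖B} · Z_{M/B}(t, (t p_e/(1−2p_e))_{e∈E∖B}). -/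

import Mathlib

open Finset

/-- The flow polynomial of the restriction `M|A` of an rsm over `ℝ`:
`F_{M|A}(t) = ∑_{B⊆A} (−1)^{|A∖B|} m(B) t^{|B|−r(B)}` (integer powers). -/
noncomputable def flowRes {α : Type*} [DecidableEq α]
    (r : Finset α → ℤ) (m : Finset α → ℝ) (A : Finset α) (t : ℝ) : ℝ :=
  ∑ B ∈ A.powerset, (-1 : ℝ) ^ (A \ B).card * m B * t ^ ((B.card : ℤ) - r B)

/-- `Z_{M/B}(q,w) = ∑_{C⊆E∖B} m(B∪C) q^{r(B)−r(B∪C)} w^C`, the multivariate Tutte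
polynomial of the contraction `M/B`. -/
noncomputable def ZmultiCon {α : Type*} [Fintype α] [DecidableEq α]
    (r : Finset α → ℤ) (m : Finset α → ℝ) (B : Finset α) (q : ℝ) (w : α → ℝ) : ℝ :=
  ∑ C ∈ Bᶜ.powerset, m (B ∪ C) * q ^ (r B - r (B ∪ C)) * ∏ e ∈ C, w e

theorem sum_filter_superset_eq_sum_powerset_compl {α : Type*} [Fintype α] [DecidableEq α]
    (B : Finset α) (f : Finset α → ℝ) :
    ∑ A ∈ univ.filter (fun A => B ⊆ A), f A = ∑ C ∈ Bᶜ.powerset, f (B ∪ C) := by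
  refine Finset.sum_bij' (fun A _ => A \ B) (fun C _ => B ∪ C) ?_ ?_ ?_ ?_ ?_
  · intro A _
    rw [mem_powerset]
    intro x hx
    simp_all
  · intro C _
    simp
  · intro A hA
    exact union_sdiff_of_subset (mem_filter.1 hA).2
  · intro C hC
    refine union_sdiff_cancel_left ?_
    exact disjoint_compl_right.mono_right (mem_powerset.1 hC)
  · intro A hA
    rw [union_sdiff_of_subset (mem_filter.1 hA).2]

theorem sum_superset_neg_one_pow_mul_prod {α : Type*} [Fintype α] [DecidableEq α]
    (p : α → ℝ) (B : Finset α) :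
    ∑ A ∈ univ.filter (fun A => B ⊆ A),
        (-1 : ℝ) ^ (A \ B).card * (∏ e ∈ A, p e) * ∏ e ∈ Aᶜ, (1 - p e) =
      (∏ e ∈ B, p e) * ∏ e ∈ Bᶜ, (1 - 2 * p e) := by
  rw [sum_filter_superset_eq_sum_powerset_compl]
  have h : ∏ e ∈ Bᶜ, (1 - 2 * p e) = ∏ e ∈ Bᶜ, (-p e + (1 - p e)) :=
    prod_congr rfl fun e _ => by ring
  rw [h, prod_add, mul_sum]
  refine sum_congr rfl fun C hC => ?_
  have hd : Disjoint B C := disjoint_compl_right.mono_right (mem_powerset.1 hC)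
  rw [union_sdiff_cancel_left hd, prod_union hd, prod_neg, compl_union, sdiff_eq_inter_compl]
  ring

theorem sum_flowRes_mul_prod {α : Type*} [Fintype α] [DecidableEq α]
    (r : Finset α → ℤ) (m : Finset α → ℝ) (t : ℝ) (p : α → ℝ) :
    (∑ A : Finset α, flowRes r m A t * (∏ e ∈ A, p e) * ∏ e ∈ Aᶜ, (1 - p e)) =
      ∑ A : Finset α, m A * t ^ ((A.card : ℤ) - r A) * (∏ e ∈ A, p e) *
        ∏ e ∈ Aᶜ, (1 - 2 * p e) := by
  simp only [flowRes, sum_mul]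
  rw [sum_comm' (t' := univ) (s' := fun B => univ.filter (fun A => B ⊆ A)) (by simp)]
  refine sum_congr rfl fun B _ => ?_
  rw [mul_assoc, ← sum_superset_neg_one_pow_mul_prod, mul_sum]
  exact sum_congr rfl fun A _ => by ring

theorem sum_mul_prod_eq_ZmultiCon {α : Type*} [Fintype α] [DecidableEq α]
    (r : Finset α → ℤ) (m : Finset α → ℝ) {t : ℝ} (ht : t ≠ 0) (p : α → ℝ) (B : Finset α)
    (hB : ∀ e, e ∈ B ↔ p e = 1 / 2) :
    (∑ A : Finset α, m A * t ^ ((A.card : ℤ) - r A) * (∏ e ∈ A, p e) *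
        ∏ e ∈ Aᶜ, (1 - 2 * p e)) =
      (2 : ℝ) ^ (-(B.card : ℤ)) * t ^ ((B.card : ℤ) - r B) * (∏ e ∈ Bᶜ, (1 - 2 * p e)) *
        ZmultiCon r m B t (fun e => t * p e / (1 - 2 * p e)) := by
  rw [← sum_subset (subset_univ (univ.filter (fun A => B ⊆ A))),
    sum_filter_superset_eq_sum_powerset_compl, ZmultiCon, mul_sum]
  · refine sum_congr rfl fun C hC => ?_
    have hC' := mem_powerset.1 hC
    have hd : Disjoint B C := disjoint_compl_right.mono_right hC'
    have hp : ∏ e ∈ B, p e = (2 : ℝ) ^ (-(B.card : ℤ)) := by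
      rw [prod_congr rfl fun e he => (hB e).1 he, prod_const, zpow_neg, zpow_natCast]
      simp
    have hne : ∏ e ∈ C, (1 - 2 * p e) ≠ 0 := by
      refine prod_ne_zero_iff.2 fun e he h => ?_
      exact mem_compl.1 (hC' he) ((hB e).2 (by linarith))
    have hz : t ^ (((B ∪ C).card : ℤ) - r (B ∪ C)) =
        t ^ ((B.card : ℤ) - r B) * t ^ (r B - r (B ∪ C)) * t ^ C.card := by
      rw [← zpow_natCast t C.card, ← zpow_add₀ ht, ← zpow_add₀ ht, card_union_of_disjoint hd]
      congr 1
      push_cast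
      ring
    have hs : ∏ e ∈ Bᶜ, (1 - 2 * p e) =
        (∏ e ∈ (B ∪ C)ᶜ, (1 - 2 * p e)) * ∏ e ∈ C, (1 - 2 * p e) := by
      rw [← prod_sdiff hC', compl_union, sdiff_eq_inter_compl]
    rw [prod_union hd, hp, hz, hs, prod_div_distrib, prod_mul_distrib, prod_const]
    field_simp
  · intro A _ hA
    obtain ⟨e, heB, heA⟩ := not_subset.1 fun h => hA (mem_filter.2 ⟨mem_univ A, h⟩)
    rw [prod_eq_zero (mem_compl.2 heA) (by rw [(hB e).1 heB]; norm_num), mul_zero]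

/-- **Theorem 3.17** (expected flow polynomial): for an rsm `M = (E,r,m)` over `ℝ`, `t ≠ 0`
and every real family `p`,
`E[F_{M|E_p}(t)] = ∑_{A⊆E} m(A) t^{|A|−r(A)} p^A (1−2p)^{E∖A}`.
Moreover, with `B = {e ∈ E : p_e = 1/2}`: if `B = E` then
`E[F_{M|E_p}(t)] = 2^{−|E|} t^{|E|−r(E)} m(E)`, and if `B ⊊ E` then
`E[F_{M|E_p}(t)] = 2^{−|B|} t^{|B|−r(B)} (1−2p)^{E∖B} Z_{M/B}(t, (t p_e/(1−2p_e)))`. -/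
theorem expectation_flow {α : Type*} [Fintype α] [DecidableEq α]
    (r : Finset α → ℤ) (m : Finset α → ℝ) (t : ℝ) (ht : t ≠ 0) (p : α → ℝ) :
    ((∑ A : Finset α, flowRes r m A t * (∏ e ∈ A, p e) * ∏ e ∈ Aᶜ, (1 - p e)) =
        ∑ A : Finset α, m A * t ^ ((A.card : ℤ) - r A) * (∏ e ∈ A, p e) *
          ∏ e ∈ Aᶜ, (1 - 2 * p e)) ∧
    (Finset.univ.filter (fun e => p e = 1/2) = Finset.univ →
      (∑ A : Finset α, flowRes r m A t * (∏ e ∈ A, p e) * ∏ e ∈ Aᶜ, (1 - p e)) =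
        (2 : ℝ) ^ (-(Fintype.card α : ℤ)) *
          t ^ ((Fintype.card α : ℤ) - r Finset.univ) * m Finset.univ) ∧
    (Finset.univ.filter (fun e => p e = 1/2) ⊂ Finset.univ →
      (∑ A : Finset α, flowRes r m A t * (∏ e ∈ A, p e) * ∏ e ∈ Aᶜ, (1 - p e)) =
        (2 : ℝ) ^ (-((Finset.univ.filter (fun e => p e = 1/2)).card : ℤ)) *
          t ^ (((Finset.univ.filter (fun e => p e = 1/2)).card : ℤ) -
            r (Finset.univ.filter (fun e => p e = 1/2))) *
          (∏ e ∈ (Finset.univ.filter (fun e => p e = 1/2))ᶜ, (1 - 2 * p e)) *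
          ZmultiCon r m (Finset.univ.filter (fun e => p e = 1/2)) t
            (fun e => t * p e / (1 - 2 * p e))) := by
  have hB : ∀ e, e ∈ univ.filter (fun e => p e = 1/2) ↔ p e = 1 / 2 := by simp
  refine ⟨sum_flowRes_mul_prod r m t p, fun h => ?_, fun _ => ?_⟩
  · rw [sum_flowRes_mul_prod, sum_mul_prod_eq_ZmultiCon r m ht p _ hB, h]
    simp [ZmultiCon]
  · rw [sum_flowRes_mul_prod, sum_mul_prod_eq_ZmultiCon r m ht p _ hB]
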